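/- Let t be a translation of the Coxeter building Σ(W,S) (an automorphism mapping every root to a parallel root) and let (c_0, ..., c_k = t(c_0)) be a minimal gallery. Then for every n ∈ ℕ, the concatenation of the galleries (t^i(c_0), ..., t^i(c_k)) for 0 ≤ i ≤ n is a minimal gallery. -/

import Mathlib

namespace CoxeterBuilding

variable {B : Type*} {W : Type*} [Group W] {M : CoxeterMatrix B}

/-- The simple root α_s = {w ∈ W : ℓ(sw) > ℓ(w)} of the Coxeter building Σ(W,S). -/
def simpleRoot (cs : CoxeterSystem M W) (s : B) : Set W :=
  {w : W | cs.length w < cs.length (cs.simple s * w)}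

/-- A root of Σ(W,S): a translate v·α_s of a simple root. -/
def IsRoot (cs : CoxeterSystem M W) (α : Set W) : Prop :=
  ∃ (v : W) (s : B), α = (fun w => v * w) '' simpleRoot cs s

/-- A gallery in the Coxeter building Σ(W,S) (Weyl distance δ(x,y) = x⁻¹y). -/
def IsGallery (cs : CoxeterSystem M W) (d : ℕ → W) (k : ℕ) : Prop :=
  ∀ i < k, ∃ s : B, (d i)⁻¹ * d (i + 1) = cs.simple s

/-- A minimal gallery: no shorter gallery with the same endpoints. -/
def IsMinimalGallery (cs : CoxeterSystem M W) (d : ℕ → W) (k : ℕ) : Prop :=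
  IsGallery cs d k ∧
    ∀ (e : ℕ → W) (m : ℕ), IsGallery cs e m → e 0 = d 0 → e m = d k → k ≤ m

/-- The gallery `d` crosses the wall ∂α at step `i + 1` iff exactly one of
`d i`, `d (i+1)` lies in the root α. -/
def CrossesAt (α : Set W) (d : ℕ → W) (i : ℕ) : Prop :=
  ¬ (d i ∈ α ↔ d (i + 1) ∈ α)

/-- The gallery `d` of length `k` crosses each wall at most once. -/
def CrossesEachWallAtMostOnce (cs : CoxeterSystem M W) (d : ℕ → W) (k : ℕ) : Prop :=
  ∀ α : Set W, IsRoot cs α → {i : ℕ | i < k ∧ CrossesAt α d i}.Subsingleton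

end CoxeterBuilding

namespace CoxeterBuilding

section aux
variable {B : Type*} {W : Type*} [Group W] {M : CoxeterMatrix B}

open Classical in
/-- The elementary permutation attached to a simple generator. -/
noncomputable def phi (cs : CoxeterSystem M W) (i : B) : Equiv.Perm (W × ZMod 2) where
  toFun p := (cs.simple i * p.1 * cs.simple i, p.2 + if p.1 = cs.simple i then 1 else 0)
  invFun p := (cs.simple i * p.1 * cs.simple i, p.2 + if p.1 = cs.simple i then 1 else 0)
  left_inv p := by
    have h : cs.simple i * p.1 * cs.simple i = cs.simple i ↔ p.1 = cs.simple i := by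
      constructor
      · intro h
        have := congrArg (fun x => cs.simple i * x * cs.simple i) h
        simpa [mul_assoc] using this
      · intro h; simp [h]
    ext
    · simp [mul_assoc]
    · simp only [h, add_assoc, CharTwo.add_self_eq_zero, add_zero]
  right_inv p := by
    have h : cs.simple i * p.1 * cs.simple i = cs.simple i ↔ p.1 = cs.simple i := by
      constructor
      · intro h
        have := congrArg (fun x => cs.simple i * x * cs.simple i) h
        simpa [mul_assoc] using this
      · intro h; simp [h]
    ext
    · simp [mul_assoc]
    · simp only [h, add_assoc, CharTwo.add_self_eq_zero, add_zero]

open Classical in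
theorem phi_apply (cs : CoxeterSystem M W) (i : B) (p : W × ZMod 2) :
    phi cs i p = (cs.simple i * p.1 * cs.simple i,
      p.2 + if p.1 = cs.simple i then 1 else 0) := rfl

open Classical in
theorem phi_pow (cs : CoxeterSystem M W) (s u : B) (n : ℕ) (r : W) (e : ZMod 2) :
    ((phi cs s * phi cs u) ^ n) (r, e) =
      ((cs.simple s * cs.simple u) ^ n * r * ((cs.simple s * cs.simple u) ^ n)⁻¹,
        e + ∑ k ∈ Finset.range (2 * n),
          if r = (cs.simple u * cs.simple s) ^ k * cs.simple u then 1 else 0) := by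
  induction n with
  | zero => simp
  | succ n ih =>
    have hinv : (cs.simple s * cs.simple u)⁻¹ = cs.simple u * cs.simple s := by simp
    have hinvn : ((cs.simple s * cs.simple u) ^ n)⁻¹ = (cs.simple u * cs.simple s) ^ n := by
      rw [← inv_pow, hinv]
    have hc : cs.simple u * (cs.simple s * cs.simple u) ^ n
        = (cs.simple u * cs.simple s) ^ n * cs.simple u := by
      have : SemiconjBy (cs.simple u) (cs.simple s * cs.simple u) (cs.simple u * cs.simple s) := by
        simp [SemiconjBy, mul_assoc]
      exact (this.pow_right n)
    rw [pow_succ', Equiv.Perm.mul_apply, ih, Equiv.Perm.mul_apply, phi_apply, phi_apply]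
    have e1 : (cs.simple s * cs.simple u) ^ n * r * ((cs.simple s * cs.simple u) ^ n)⁻¹
        = cs.simple u ↔ r = (cs.simple u * cs.simple s) ^ (2 * n) * cs.simple u := by
      rw [mul_inv_eq_iff_eq_mul, ← eq_inv_mul_iff_mul_eq, hinvn, hc, two_mul, pow_add, mul_assoc]
    have e2 : cs.simple u * ((cs.simple s * cs.simple u) ^ n * r *
        ((cs.simple s * cs.simple u) ^ n)⁻¹) * cs.simple u
        = cs.simple s ↔ r = (cs.simple u * cs.simple s) ^ (2 * n + 1) * cs.simple u := by
      have : cs.simple u * ((cs.simple s * cs.simple u) ^ n * r *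
        ((cs.simple s * cs.simple u) ^ n)⁻¹) * cs.simple u
        = cs.simple s ↔ (cs.simple s * cs.simple u) ^ n * r *
        ((cs.simple s * cs.simple u) ^ n)⁻¹ = cs.simple u * cs.simple s * cs.simple u := by
        generalize (cs.simple s * cs.simple u) ^ n * r * ((cs.simple s * cs.simple u) ^ n)⁻¹ = q
        constructor
        · intro h; rw [← h]; simp [mul_assoc]
        · intro h; rw [h]; simp [mul_assoc]
      rw [this, mul_inv_eq_iff_eq_mul, ← eq_inv_mul_iff_mul_eq, hinvn, mul_assoc _ (cs.simple u),
        hc, ← mul_assoc, ← mul_assoc, ← pow_succ, ← pow_add]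
      rw [show n + 1 + n = 2 * n + 1 by ring]
    ext
    · simp only [pow_succ', mul_inv_rev, mul_assoc, cs.inv_simple]
    · simp only [e1, e2]
      rw [show 2 * (n + 1) = 2 * n + 1 + 1 by ring, Finset.sum_range_succ, Finset.sum_range_succ]
      ring

theorem phi_liftable (cs : CoxeterSystem M W) : M.IsLiftable (phi cs) := by
  classical
  intro s u
  ext1 ⟨r, e⟩
  rw [phi_pow, cs.simple_mul_simple_pow, two_mul, Finset.sum_range_add]
  simp only [pow_add, cs.simple_mul_simple_pow', one_mul, CharTwo.add_self_eq_zero]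
  simp

/-- The permutation representation. -/
noncomputable def rep (cs : CoxeterSystem M W) : W →* Equiv.Perm (W × ZMod 2) :=
  cs.lift ⟨phi cs, phi_liftable cs⟩

theorem rep_simple (cs : CoxeterSystem M W) (i : B) : rep cs (cs.simple i) = phi cs i := by
  simp [rep]

theorem rep_apply (cs : CoxeterSystem M W) (w : W) : ∀ (r : W) (e : ZMod 2),
    rep cs w (r, e) = (w * r * w⁻¹, (rep cs w (r, 0)).2 + e) := by
  induction w using cs.simple_induction_left with
  | one => intro r e; simp
  | mul_simple_left w i ih =>
    intro r e
    rw [map_mul, Equiv.Perm.mul_apply, Equiv.Perm.mul_apply, ih r e, ih r 0, rep_simple,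
      phi_apply, phi_apply]
    ext
    · simp [mul_assoc]
    · simp only; ring

/-- Parity of the number of crossings of the wall `r` between `1` and `x`. -/
noncomputable def par (cs : CoxeterSystem M W) (x r : W) : ZMod 2 := (rep cs x⁻¹ (r, 0)).2

theorem par_one (cs : CoxeterSystem M W) (r : W) : par cs 1 r = 0 := by simp [par]

open Classical in
theorem par_mul_simple (cs : CoxeterSystem M W) (x r : W) (u : B) :
    par cs (x * cs.simple u) r =
      par cs x r + if r = x * cs.simple u * x⁻¹ then 1 else 0 := by
  have h : x⁻¹ * r * x = cs.simple u ↔ r = x * cs.simple u * x⁻¹ := by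
    constructor
    · intro h; rw [← h]; group
    · intro h; rw [h]; group
  unfold par
  rw [mul_inv_rev, cs.inv_simple, map_mul, Equiv.Perm.mul_apply, rep_apply cs x⁻¹ r 0, rep_simple,
    phi_apply]
  simp [h]

theorem par_simple_mul (cs : CoxeterSystem M W) (x : W) (s : B) :
    par cs (cs.simple s * x) (cs.simple s) = par cs x (cs.simple s) + 1 := by
  unfold par
  rw [mul_inv_rev, cs.inv_simple, map_mul, Equiv.Perm.mul_apply, rep_simple, phi_apply, rep_apply]
  simp

theorem mem_lis_of_par (cs : CoxeterSystem M W) (r : W) (ω : List B) :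
    par cs (cs.wordProd ω) r ≠ 0 → r ∈ cs.leftInvSeq ω := by
  classical
  induction ω using List.reverseRecOn with
  | nil => simp [par_one]
  | append_singleton ω i ih =>
    intro h
    rw [← List.concat_eq_append, cs.leftInvSeq_concat]
    rw [cs.wordProd_append, cs.wordProd_singleton, par_mul_simple] at h
    by_cases hr : r = cs.wordProd ω * cs.simple i * (cs.wordProd ω)⁻¹
    · simp [← hr]
    · simp only [hr, if_false, add_zero] at h
      simp [ih h]

theorem length_lt_of_par (cs : CoxeterSystem M W) (x : W) (s : B)
    (h : par cs x (cs.simple s) ≠ 0) : cs.length (cs.simple s * x) < cs.length x := by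
  obtain ⟨ω, hω, rfl⟩ := cs.exists_isReduced x
  exact (cs.isLeftInversion_of_mem_leftInvSeq hω (mem_lis_of_par cs _ ω h)).2

theorem mem_simpleRoot_iff (cs : CoxeterSystem M W) (x : W) (s : B) :
    x ∈ simpleRoot cs s ↔ par cs x (cs.simple s) = 0 := by
  constructor
  · intro h
    by_contra h'
    exact absurd (length_lt_of_par cs x s h') (not_lt.2 (le_of_lt h))
  · intro h
    have := length_lt_of_par cs (cs.simple s * x) s (by rw [par_simple_mul, h]; simp)
    simpa [simpleRoot] using this

theorem mem_root_iff (cs : CoxeterSystem M W) (v x : W) (s : B) :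
    x ∈ (fun w => v * w) '' simpleRoot cs s ↔ par cs (v⁻¹ * x) (cs.simple s) = 0 := by
  rw [← mem_simpleRoot_iff]
  constructor
  · rintro ⟨y, hy, rfl⟩; simpa using hy
  · intro h; exact ⟨_, h, by simp⟩

/-- The reflection of the wall crossed at step `i`. -/
def wall (d : ℕ → W) (i : ℕ) : W := d (i + 1) * (d i)⁻¹

theorem crosses_iff (cs : CoxeterSystem M W) (d : ℕ → W) (i : ℕ) (v : W) (s u : B)
    (hu : (d i)⁻¹ * d (i + 1) = cs.simple u) :
    CrossesAt ((fun w => v * w) '' simpleRoot cs s) d i ↔ v * cs.simple s * v⁻¹ = wall d i := by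
  classical
  have hd : d (i + 1) = d i * cs.simple u := by rw [← hu]; group
  have h : cs.simple s = v⁻¹ * d i * cs.simple u * (v⁻¹ * d i)⁻¹ ↔
      v * cs.simple s * v⁻¹ = d i * cs.simple u * (d i)⁻¹ := by
    constructor
    · intro h; rw [h]; group
    · intro h
      have : cs.simple s = v⁻¹ * (v * cs.simple s * v⁻¹) * v := by group
      rw [this, h]; group
  unfold CrossesAt wall
  rw [mem_root_iff, mem_root_iff, hd, ← mul_assoc, par_mul_simple, ← h]
  generalize par cs (v⁻¹ * d i) (cs.simple s) = a
  split_ifs with hh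
  · simp only [hh, iff_true]
    revert a; decide
  · simp only [hh, iff_false, add_zero, not_true, not_false_eq_true]

theorem wall_of (cs : CoxeterSystem M W) (d : ℕ → W) (i : ℕ) (u : B)
    (hu : (d i)⁻¹ * d (i + 1) = cs.simple u) : wall d i = d i * cs.simple u * (d i)⁻¹ := by
  rw [← hu, wall]; group

theorem crossesOnce_iff (cs : CoxeterSystem M W) (d : ℕ → W) (k : ℕ) (hd : IsGallery cs d k) :
    CrossesEachWallAtMostOnce cs d k ↔ ∀ i < k, ∀ j < k, wall d i = wall d j → i = j := by
  constructor
  · intro h i hi j hj hij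
    obtain ⟨u, hu⟩ := hd i hi
    obtain ⟨u', hu'⟩ := hd j hj
    refine h _ ⟨d i, u, rfl⟩ ⟨hi, ?_⟩ ⟨hj, ?_⟩
    · rw [crosses_iff cs d i _ _ u hu, wall_of cs d i u hu]
    · rw [crosses_iff cs d j _ _ u' hu', ← hij, wall_of cs d i u hu]
  · rintro h α ⟨v, s, rfl⟩ i ⟨hi, hci⟩ j ⟨hj, hcj⟩
    obtain ⟨u, hu⟩ := hd i hi
    obtain ⟨u', hu'⟩ := hd j hj
    rw [crosses_iff cs d i _ _ u hu] at hci
    rw [crosses_iff cs d j _ _ u' hu'] at hcj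
    exact h i hi j hj (hci.symm.trans hcj)

open Classical in
theorem par_gallery (cs : CoxeterSystem M W) (d : ℕ → W) (k : ℕ) (hd : IsGallery cs d k) (r : W) :
    par cs (d k) r = par cs (d 0) r + ∑ i ∈ Finset.range k, if r = wall d i then 1 else 0 := by
  induction k with
  | zero => simp
  | succ k ih =>
    obtain ⟨u, hu⟩ := hd k (Nat.lt_succ_self k)
    have hdk : d (k + 1) = d k * cs.simple u := by rw [← hu]; group
    rw [hdk, par_mul_simple, ih (fun i hi => hd i (by omega)), Finset.sum_range_succ,
      wall_of cs d k u hu, add_assoc]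

theorem minimal_of_crossesOnce (cs : CoxeterSystem M W) (d : ℕ → W) (k : ℕ)
    (hd : IsGallery cs d k) (h : CrossesEachWallAtMostOnce cs d k) : IsMinimalGallery cs d k := by
  classical
  rw [crossesOnce_iff cs d k hd] at h
  refine ⟨hd, fun e m he h0 hm => ?_⟩
  have hsub : (Finset.range k).image (wall d) ⊆ (Finset.range m).image (wall e) := by
    intro r hr
    obtain ⟨j, hj, rfl⟩ := Finset.mem_image.1 hr
    rw [Finset.mem_range] at hj
    by_contra hn
    have h1 := par_gallery cs d k hd (wall d j)
    have h2 := par_gallery cs e m he (wall d j)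
    rw [Finset.sum_eq_single j] at h1
    · rw [Finset.sum_eq_zero, h0, hm, h1] at h2
      · simp at h2
      · intro i hi
        rw [if_neg]
        intro hh
        exact hn (Finset.mem_image.2 ⟨i, hi, hh.symm⟩)
    · intro i hi hij
      rw [if_neg]
      intro hh
      exact hij (h i (Finset.mem_range.1 hi) j hj hh.symm)
    · intro hh; exact absurd (Finset.mem_range.2 hj) hh
  have h1 := Finset.card_le_card hsub
  rw [Finset.card_image_of_injOn] at h1
  · have h2 := Finset.card_image_le (s := Finset.range m) (f := wall e)
    simp only [Finset.card_range] at h1 h2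
    omega
  · intro i hi j hj hij
    exact h i (by simpa using hi) j (by simpa using hj) hij

theorem crossesOnce_of_minimal (cs : CoxeterSystem M W) (d : ℕ → W) (k : ℕ)
    (h : IsMinimalGallery cs d k) : CrossesEachWallAtMostOnce cs d k := by
  obtain ⟨hd, hmin⟩ := h
  rw [crossesOnce_iff cs d k hd]
  have key : ∀ i j, i < j → j < k → wall d i ≠ wall d j := by
    intro i j hij hj hw
    obtain ⟨u, hu⟩ := hd i (by omega)
    obtain ⟨u', hu'⟩ := hd j hj
    have hsq : wall d i * wall d i = 1 := by
      rw [wall_of cs d i u hu]; simp [mul_assoc]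
    have h1 : wall d i * d (i + 1) = d i := by
      have : d (i + 1) = wall d i * d i := by simp [wall]
      rw [this, ← mul_assoc, hsq, one_mul]
    have h2 : wall d i * d j = d (j + 1) := by rw [hw]; simp [wall]
    let e : ℕ → W := fun l => if l < i then d l else if l < j then wall d i * d (l + 1) else d (l + 2)
    have := hmin e (k - 2) ?_ ?_ ?_
    · omega
    · intro l hl
      rcases lt_trichotomy (l + 1) i with hli | hli | hli
      · simpa [e, show l < i by omega, hli] using hd l (by omega)
      · have : e (l + 1) = d (l + 1) := by
          simp only [e, hli, lt_irrefl, if_false, if_pos hij, h1]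
        rw [this]
        simpa [e, show l < i by omega] using hd l (by omega)
      · rcases lt_trichotomy (l + 1) j with hlj | hlj | hlj
        · obtain ⟨a, ha⟩ := hd (l + 1) (by omega)
          refine ⟨a, ?_⟩
          simp only [e, show ¬ l < i by omega, show l < j by omega, hlj, show ¬ l + 1 < i by omega,
            if_true, if_false]
          rw [← ha]; group
        · obtain ⟨a, ha⟩ := hd (l + 2) (by omega)
          refine ⟨a, ?_⟩
          simp only [e, show ¬ l < i by omega, show l < j by omega, show ¬ l + 1 < j by omega,
            show ¬ l + 1 < i by omega, if_true, if_false]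
          rw [← ha, hlj, h2, ← hlj]
        · obtain ⟨a, ha⟩ := hd (l + 2) (by omega)
          refine ⟨a, ?_⟩
          simp only [e, show ¬ l < i by omega, show ¬ l < j by omega, show ¬ l + 1 < j by omega,
            show ¬ l + 1 < i by omega, if_false]
          rw [← ha]
    · by_cases h0 : 0 < i
      · simp [e, h0]
      · obtain rfl : i = 0 := by omega
        simp only [e, lt_irrefl, if_false, if_pos hij]
        exact h1
    · have hk2 : k - 2 + 2 = k := by omega
      by_cases hjk : k - 2 < j
      · have : j = k - 1 := by omega
        simp only [e, show ¬ k - 2 < i by omega, hjk, if_true, if_false]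
        rw [show k - 2 + 1 = j by omega, h2]
        congr 1; omega
      · simp only [e, show ¬ k - 2 < i by omega, hjk, if_false, hk2]
  intro i hi j hj hij
  rcases lt_trichotomy i j with h | h | h
  · exact absurd hij (key i j h hj)
  · exact h
  · exact absurd hij.symm (key j i h hi)

theorem const_of_no_cross (α : Set W) (g : ℕ → W) (a b : ℕ) (hab : a ≤ b)
    (h : ∀ i, a ≤ i → i < b → ¬ CrossesAt α g i) : g a ∈ α ↔ g b ∈ α := by
  induction b, hab using Nat.le_induction with
  | base => rfl
  | succ b hb ih =>
    rw [ih (fun i h1 h2 => h i h1 (by omega))]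
    exact not_not.1 (h b hb (Nat.lt_succ_self b))

theorem cross_ends (cs : CoxeterSystem M W) (α : Set W) (hα : IsRoot cs α) (g : ℕ → W) (k l : ℕ)
    (hl : l < k) (h : IsMinimalGallery cs g k) (hc : CrossesAt α g l) :
    (g 0 ∈ α ↔ g l ∈ α) ∧ (g (l + 1) ∈ α ↔ g k ∈ α) := by
  have ho := crossesOnce_of_minimal cs g k h α hα
  constructor
  · refine const_of_no_cross α g 0 l (Nat.zero_le _) fun i _ hi hci => ?_
    have := ho ⟨by omega, hci⟩ ⟨hl, hc⟩
    omega
  · refine const_of_no_cross α g (l + 1) k hl fun i hi hik hci => ?_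
    have := ho ⟨hik, hci⟩ ⟨hl, hc⟩
    omega

theorem minimal_map (cs : CoxeterSystem M W) (t : W ≃ W)
    (haut : ∃ σ : B ≃ B, (∀ s u : B, M (σ s) (σ u) = M s u) ∧
      ∀ (x y : W) (s : B),
        x⁻¹ * y = cs.simple s ↔ (t x)⁻¹ * t y = cs.simple (σ s))
    (g : ℕ → W) (k : ℕ) (h : IsMinimalGallery cs g k) :
    IsMinimalGallery cs (fun j => t (g j)) k := by
  obtain ⟨σ, -, hσ⟩ := haut
  refine ⟨fun i hi => ?_, fun e m he h0 hm => ?_⟩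
  · obtain ⟨s, hs⟩ := h.1 i hi
    exact ⟨σ s, (hσ _ _ _).1 hs⟩
  · refine h.2 (fun j => t.symm (e j)) m (fun i hi => ?_) (by simp [h0]) (by simp [hm])
    obtain ⟨s, hs⟩ := he i hi
    refine ⟨σ.symm s, (hσ _ _ _).2 ?_⟩
    simpa using hs

theorem minimal_iter (cs : CoxeterSystem M W) (t : W ≃ W)
    (haut : ∃ σ : B ≃ B, (∀ s u : B, M (σ s) (σ u) = M s u) ∧
      ∀ (x y : W) (s : B),
        x⁻¹ * y = cs.simple s ↔ (t x)⁻¹ * t y = cs.simple (σ s))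
    (g : ℕ → W) (k : ℕ) (h : IsMinimalGallery cs g k) (i : ℕ) :
    IsMinimalGallery cs (fun j => (⇑t)^[i] (g j)) k := by
  induction i with
  | zero => simpa using h
  | succ i ih =>
    simp only [Function.iterate_succ_apply']
    exact minimal_map cs t haut _ k ih

end aux

end CoxeterBuilding

open CoxeterBuilding in
/-- Let t be a translation of Σ(W,S) (an automorphism of the
building mapping every root to a parallel root) and let
(c_0, ..., c_k = t(c_0)) be a minimal gallery. Then for every n ∈ ℕ the
concatenation of the galleries (t^i(c_0), ..., t^i(c_k)), 0 ≤ i ≤ n, is a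
minimal gallery. -/
theorem translation_concatenation_minimal
    {B : Type*} {W : Type*} [Group W] {M : CoxeterMatrix B}
    (cs : CoxeterSystem M W) (t : W ≃ W)
    -- t is an automorphism of the building Σ(W,S) (a σ-isomorphism for some
    -- diagram bijection σ)
    (haut : ∃ σ : B ≃ B, (∀ s u : B, M (σ s) (σ u) = M s u) ∧
      ∀ (x y : W) (s : B),
        x⁻¹ * y = cs.simple s ↔ (t x)⁻¹ * t y = cs.simple (σ s))
    -- t maps each root to a parallel root
    (hpar : ∀ α : Set W, IsRoot cs α → (t '' α ⊆ α ∨ α ⊆ t '' α))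
    (c : ℕ → W) (k : ℕ) (hmin : IsMinimalGallery cs c k) (hend : c k = t (c 0)) :
    ∀ n : ℕ, IsMinimalGallery cs
      (fun j => (⇑t)^[j / k] (c (j % k))) ((n + 1) * k) := by
  intro n
  rcases Nat.eq_zero_or_pos k with rfl | hk
  · refine ⟨fun i hi => absurd hi (by simp), fun e m _ _ _ => by simp⟩
  have hg := minimal_iter cs t haut c k hmin
  have hgk : ∀ i, (⇑t)^[i] (c k) = t ((⇑t)^[i] (c 0)) := by
    intro i
    rw [hend, ← Function.iterate_succ_apply, Function.iterate_succ_apply']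
  -- decomposition of a step
  have hstep : ∀ j, ((fun j => (⇑t)^[j / k] (c (j % k))) (j + 1))
      = (⇑t)^[j / k] (c (j % k + 1)) := by
    intro j
    have hl := Nat.mod_lt j hk
    have hj := Nat.div_add_mod j k
    show (⇑t)^[(j + 1) / k] (c ((j + 1) % k)) = _
    rcases Nat.lt_or_ge (j % k + 1) k with h | h
    · have hj1 : j + 1 = (j % k + 1) + k * (j / k) := by omega
      have h1 : (j + 1) / k = j / k := by
        conv_lhs => rw [hj1]
        rw [Nat.add_mul_div_left _ _ hk, Nat.div_eq_of_lt h, zero_add]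
      have h2 : (j + 1) % k = j % k + 1 := by
        conv_lhs => rw [hj1]
        rw [Nat.add_mul_mod_self_left, Nat.mod_eq_of_lt h]
      rw [h1, h2]
    · have he : j % k + 1 = k := by omega
      have hj1 : j + 1 = k * (j / k + 1) := by rw [mul_add]; omega
      have h1 : (j + 1) / k = j / k + 1 := by
        conv_lhs => rw [hj1]
        rw [Nat.mul_div_cancel_left _ hk]
      have h2 : (j + 1) % k = 0 := by
        conv_lhs => rw [hj1]
        rw [Nat.mul_mod_right]
      rw [h1, h2, he, hgk, Function.iterate_succ_apply']
  generalize hd : (fun j => (⇑t)^[j / k] (c (j % k))) = d at hstep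
  have hd0 : ∀ j, d j = (⇑t)^[j / k] (c (j % k)) := fun j => by rw [← hd]
  have hgal : ∀ N, IsGallery cs d N := by
    intro N j _
    rw [hstep j, hd0 j]
    exact (hg (j / k)).1 (j % k) (Nat.mod_lt j hk)
  refine minimal_of_crossesOnce cs d _ (hgal _) ?_
  intro α hα
  -- the step data
  have hends : ∀ j, CrossesAt α d j → ∃ x, (x ∈ α ↔ d j ∈ α) ∧ (d (j + 1) ∈ α ↔ t x ∈ α) := by
    intro j hc
    have hc' : CrossesAt α (fun l => (⇑t)^[j / k] (c l)) (j % k) := by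
      unfold CrossesAt at hc ⊢
      rwa [hstep j, hd0 j] at hc
    have := cross_ends cs α hα _ k (j % k) (Nat.mod_lt j hk) (hg (j / k)) hc'
    refine ⟨(⇑t)^[j / k] (c 0), ?_, ?_⟩
    · rw [hd0 j]; exact this.1
    · rw [hstep j, ← hgk]; exact this.2
  have key : ∀ a b, a < b → CrossesAt α d a → CrossesAt α d b → False := by
    intro a b hab ha hb
    rcases hpar α hα with hp | hp
    · have mono : ∀ j, d j ∈ α → d (j + 1) ∈ α := by
        intro j hj
        by_contra hn
        obtain ⟨x, h1, h2⟩ := hends j (fun h => hn (h.1 hj))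
        exact hn (h2.2 (hp ⟨x, h1.2 hj, rfl⟩))
      have mono' : ∀ i j, i ≤ j → d i ∈ α → d j ∈ α := by
        intro i j hij hi
        induction j, hij using Nat.le_induction with
        | base => exact hi
        | succ j _ ih => exact mono j ih
      have h1 : d (a + 1) ∈ α := by
        by_contra hn
        exact ha ⟨mono a, fun h => absurd h hn⟩
      exact hb ⟨mono b, fun _ => mono' (a + 1) b hab h1⟩
    · have mono : ∀ j, d j ∉ α → d (j + 1) ∉ α := by
        intro j hj hn
        obtain ⟨x, h1, h2⟩ := hends j (fun h => hj (h.2 hn))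
        obtain ⟨y, hy, hyx⟩ := hp (h2.1 hn)
        rw [t.injective hyx] at hy
        exact hj (h1.1 hy)
      have mono' : ∀ i j, i ≤ j → d i ∉ α → d j ∉ α := by
        intro i j hij hi
        induction j, hij using Nat.le_induction with
        | base => exact hi
        | succ j _ ih => exact mono j ih
      have h1 : d (a + 1) ∉ α := by
        intro hn
        exact ha ⟨fun _ => hn, fun _ => by_contra fun h => mono a h hn⟩
      have h2 := mono' (a + 1) b hab h1
      exact hb ⟨fun h => absurd h h2, fun h => absurd h (mono b h2)⟩
  rintro a ⟨_, ha⟩ b ⟨_, hb⟩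
  rcases lt_trichotomy a b with h | h | h
  · exact (key a b h ha hb).elim
  · exact h
  · exact (key b a h hb ha).elim
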